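/- Let R be a commutative ring, L ∈ R and g a natural number. Suppose f = Σ_{i=0}^{2g} a_i X^i ∈ R[X] is a polynomial of degree at most 2g whose coefficients satisfy the symmetry a_{2g−i} = L^{g−i}·a_i for all 0 ≤ i ≤ g. Then there exist N_0, …, N_g ∈ R such that f = Σ_{i=0}^{g} N_i · X^i · ((1−X)(1−L·X))^{g−i} in R[X]. -/

import Mathlib

open Polynomial

theorem coeff_one_sub_X_mul_one_sub_C_mul_X_mul {R : Type*} [CommRing R] (L : R) (p : R[X]) :
    ((1 - X) * (1 - C L * X) * p).coeff 0 = p.coeff 0 ∧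
    ((1 - X) * (1 - C L * X) * p).coeff 1 = p.coeff 1 - (1 + L) * p.coeff 0 ∧
    ∀ n : ℕ, ((1 - X) * (1 - C L * X) * p).coeff (n + 2) =
      p.coeff (n + 2) - (1 + L) * p.coeff (n + 1) + L * p.coeff n := by
  have h : (1 - X) * (1 - C L * X) * p = p - C (1 + L) * (X * p) + C L * (X * (X * p)) := by
    rw [C_add, C_1]
    ring
  have h1 (s : R[X]) : (X * s).coeff 1 = s.coeff 0 := coeff_X_mul s 0
  simp only [h, coeff_add, coeff_sub, coeff_C_mul, coeff_X_mul, coeff_X_mul_zero, h1]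
  simp

theorem natDegree_one_sub_X_mul_one_sub_C_mul_X_pow_le {R : Type*} [CommRing R] (L : R) (g : ℕ) :
    (((1 - X) * (1 - C L * X)) ^ g : R[X]).natDegree ≤ 2 * g := by
  have h : ((1 - X) * (1 - C L * X) : R[X]).natDegree ≤ 2 := by
    compute_degree
  exact (natDegree_pow_le_of_le g h).trans_eq (mul_comm g 2)

theorem coeff_one_sub_X_mul_one_sub_C_mul_X_pow_symm {R : Type*} [CommRing R] (L : R) (g : ℕ) :
    ∀ i : ℕ, i ≤ g → (((1 - X) * (1 - C L * X)) ^ g : R[X]).coeff (2 * g - i) =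
      L ^ (g - i) * (((1 - X) * (1 - C L * X)) ^ g : R[X]).coeff i := by
  induction g with
  | zero => simp
  | succ g ih =>
    intro i hi
    have hdeg := natDegree_one_sub_X_mul_one_sub_C_mul_X_pow_le L g
    rw [pow_succ']
    generalize ((1 - X) * (1 - C L * X) : R[X]) ^ g = p at ih hdeg ⊢
    obtain ⟨h0, h1, h2⟩ := coeff_one_sub_X_mul_one_sub_C_mul_X_mul L p
    obtain rfl | hi' := hi.eq_or_lt
    · rw [show 2 * (g + 1) - (g + 1) = g + 1 by lia]
      simp
    obtain ⟨k, rfl⟩ := Nat.exists_eq_add_of_le (Nat.lt_succ_iff.mp hi')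
    have hi0 := ih i (by lia)
    match i with
    | 0 =>
      rw [show 2 * (0 + k + 1) - 0 = 2 * k + 2 by lia, h2, h0,
        coeff_eq_zero_of_natDegree_lt (n := 2 * k + 2) (by lia),
        coeff_eq_zero_of_natDegree_lt (n := 2 * k + 1) (by lia)]
      simp only [zero_add, Nat.sub_zero] at hi0 ⊢
      rw [hi0]
      ring
    | 1 =>
      have hi1 := ih 0 (by lia)
      rw [show 2 * (1 + k + 1) - 1 = 2 * k + 1 + 2 by lia, h2, h1,
        coeff_eq_zero_of_natDegree_lt (n := 2 * k + 1 + 2) (by lia)]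
      rw [show 2 * (1 + k) - 1 = 2 * k + 1 by lia, show 1 + k - 1 = k by lia] at hi0
      rw [show 2 * (1 + k) - 0 = 2 * k + 1 + 1 by lia, show 1 + k - 0 = k + 1 by lia] at hi1
      rw [hi0, hi1, show 1 + k + 1 - 1 = k + 1 by lia]
      ring
    | j + 2 =>
      have hi1 := ih (j + 1) (by lia)
      have hi2 := ih j (by lia)
      rw [show 2 * (j + 2 + k + 1) - (j + 2) = j + 2 * k + 2 + 2 by lia, h2, h2]
      rw [show 2 * (j + 2 + k) - (j + 2) = j + 2 * k + 2 by lia,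
        show j + 2 + k - (j + 2) = k by lia] at hi0
      rw [show 2 * (j + 2 + k) - (j + 1) = j + 2 * k + 2 + 1 by lia,
        show j + 2 + k - (j + 1) = k + 1 by lia] at hi1
      rw [show 2 * (j + 2 + k) - j = j + 2 * k + 2 + 2 by lia,
        show j + 2 + k - j = k + 2 by lia] at hi2
      rw [hi0, hi1, hi2, show j + 2 + k + 1 - (j + 2) = k + 1 by lia]
      ring

/-- Let `R` be a commutative ring, `L ∈ R` and `g` a natural number.
If `f ∈ R[X]` has degree at most `2g` and its coefficients satisfy the symmetry
`a_{2g-i} = L^{g-i} * a_i` for all `0 ≤ i ≤ g`, then there exist `N_0, …, N_g ∈ R` with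
`f = ∑_{i=0}^{g} N_i * X^i * ((1-X)(1-L*X))^{g-i}`. -/
theorem severi_symmetry_span (R : Type*) [CommRing R] (L : R) (g : ℕ) (f : R[X])
    (hdeg : f.natDegree ≤ 2 * g)
    (hsym : ∀ i : ℕ, i ≤ g → f.coeff (2 * g - i) = L ^ (g - i) * f.coeff i) :
    ∃ N : ℕ → R, f = ∑ i ∈ Finset.range (g + 1),
      C (N i) * X ^ i * ((1 - X) * (1 - C L * X)) ^ (g - i) := by
  induction g generalizing f with
  | zero => exact ⟨fun _ => f.coeff 0, by simpa using eq_C_of_natDegree_le_zero hdeg⟩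
  | succ g ih =>
    set q : R[X] := ((1 - X) * (1 - C L * X)) ^ (g + 1) with hq
    set r : R[X] := f - C (f.coeff 0) * q with hr
    have hr0 : r.coeff 0 = 0 := by
      simp [hr, hq, coeff_zero_eq_eval_zero]
    have hrsym : ∀ i : ℕ, i ≤ g + 1 →
        r.coeff (2 * (g + 1) - i) = L ^ (g + 1 - i) * r.coeff i := by
      intro i hi
      simp only [hr, coeff_sub, coeff_C_mul, hsym i hi, hq,
        coeff_one_sub_X_mul_one_sub_C_mul_X_pow_symm L (g + 1) i hi]
      ring
    have hrdeg : ∀ n, 2 * g + 2 ≤ n → r.coeff n = 0 := by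
      intro n hn
      obtain rfl | hn := hn.eq_or_lt
      · simpa [hr0, mul_add] using hrsym 0 (by lia)
      · have hqdeg : q.natDegree ≤ _ := natDegree_one_sub_X_mul_one_sub_C_mul_X_pow_le L (g + 1)
        rw [hr, coeff_sub, coeff_C_mul, coeff_eq_zero_of_natDegree_lt (p := f) (by lia),
          coeff_eq_zero_of_natDegree_lt (p := q) (by lia)]
        simp
    have hrX : r = X * r.divX := by
      simpa [hr0] using (X_mul_divX_add r).symm
    obtain ⟨N, hN⟩ := ih r.divX
      (natDegree_le_iff_coeff_eq_zero.mpr fun n hn => by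
        rw [coeff_divX]
        exact hrdeg _ (by lia))
      (fun i hi => by
        rw [coeff_divX, coeff_divX, show 2 * g - i + 1 = 2 * (g + 1) - (i + 1) by lia,
          hrsym _ (by lia), Nat.add_sub_add_right])
    refine ⟨fun i => Nat.casesOn i (f.coeff 0) N, ?_⟩
    rw [Finset.sum_range_succ']
    have hf : f = X * r.divX + C (f.coeff 0) * q := by
      rw [← hrX, hr, sub_add_cancel]
    conv_lhs => rw [hf, hN, Finset.mul_sum]
    simp only [pow_zero, mul_one, Nat.sub_zero, Nat.add_sub_add_right]
    congr 1
    exact Finset.sum_congr rfl fun i _ => by ring
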